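/- The subspaces V^0 and W_A (for A ∈ P([n])) form an internal direct sum decomposition of L(S_n): the family consisting of V^0 together with all W_A is linearly independent and its sum is all of L(S_n). Moreover, for every A ∈ P([n]), the restriction of φ_n to H_A is injective with image W_A, and dim W_A = d_{|A|}, the number of derangements of an |A|-element set. -/

import Mathlib

open Finset
abbrev InjWord (n : ℕ) := {l : List (Fin n) // l.Nodup}

namespace IncompleteRankings

variable {n : ℕ}

def content (w : InjWord n) : Finset (Fin n) := w.val.toFinset

def restrict (A : Finset (Fin n)) (w : InjWord n) : InjWord n :=
  ⟨w.val.filter (fun a => a ∈ A), w.prop.filter _⟩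

theorem perm_insertIdx {α : Type*} : ∀ (i : ℕ) (a : α) (l : List α), i ≤ l.length →
    List.Perm (l.insertIdx i a) (a :: l)
  | 0, a, l, _ => by simp
  | (i+1), a, [], h => by simp at h
  | (i+1), a, (x :: l), h => by
      rw [List.insertIdx_succ_cons]
      exact ((perm_insertIdx i a l (by simpa using h)).cons x).trans (List.Perm.swap a x l)

theorem nodup_insertIdx {l : List (Fin n)} (hl : l.Nodup) {a : Fin n} (ha : a ∉ l) (i : ℕ) :
    (l.insertIdx i a).Nodup := by
  rcases le_or_gt i l.length with hi | hi
  · exact ((perm_insertIdx i a l hi).nodup_iff).mpr (List.nodup_cons.mpr ⟨ha, hl⟩)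
  · rw [List.insertIdx_of_length_lt hi]; exact hl

def insertAt (w : InjWord n) (i : ℕ) (a : Fin n) : InjWord n :=
  if h : a ∈ w.val then w else ⟨w.val.insertIdx i a, nodup_insertIdx w.prop h i⟩

abbrev FullWord (n : ℕ) := {w : InjWord n // content w = Finset.univ}

/-- The marginal operator `M_A : L(S_n) → L(Γ(A))`. -/
noncomputable def marginal (n : ℕ) (A : Finset (Fin n)) :
    (FullWord n → ℝ) →ₗ[ℝ] (InjWord n → ℝ) where
  toFun f := fun π => ∑ σ ∈ Finset.univ.filter (fun σ : FullWord n => restrict A σ.val = π), f σ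
  map_add' f g := by funext π; simp [Finset.sum_add_distrib]
  map_smul' c f := by funext π; simp [Finset.mul_sum]

/-- The embedding operator `φ_n : L(Γ_n) → L(S_n)`, sending the Dirac function of `π` to the
indicator function of the set of permutations containing `π` as a contiguous subword. -/
noncomputable def phi (n : ℕ) : (InjWord n → ℝ) →ₗ[ℝ] (FullWord n → ℝ) where
  toFun x := fun σ => ∑ π ∈ Finset.univ.filter (fun π : InjWord n => π.val <:+: σ.val.val), x π
  map_add' x y := by funext σ; simp [Finset.sum_add_distrib]
  map_smul' c x := by funext σ; simp [Finset.mul_sum]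

/-- The space `H_A ⊆ L(Γ(A))`. -/
def HSpace (n : ℕ) (A : Finset (Fin n)) : Submodule ℝ (InjWord n → ℝ) where
  carrier := {x | (∀ w : InjWord n, content w ≠ A → x w = 0) ∧
    ∀ a ∈ A, ∀ ω : InjWord n, content ω = A.erase a →
      ∑ i ∈ Finset.range (ω.val.length + 1), x (insertAt ω i a) = 0}
  add_mem' := by
    rintro x y ⟨hx1, hx2⟩ ⟨hy1, hy2⟩
    refine ⟨fun w hw => by simp [hx1 w hw, hy1 w hw], fun a ha ω hω => ?_⟩
    simp only [Pi.add_apply, Finset.sum_add_distrib, hx2 a ha ω hω, hy2 a ha ω hω, add_zero]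
  zero_mem' := ⟨fun _ _ => rfl, fun a ha ω hω => by simp⟩
  smul_mem' := by
    rintro c x ⟨hx1, hx2⟩
    refine ⟨fun w hw => by simp [hx1 w hw], fun a ha ω hω => ?_⟩
    simp only [Pi.smul_apply, smul_eq_mul, ← Finset.mul_sum, hx2 a ha ω hω, mul_zero]

/-- The space `W_A = φ_n(H_A) ⊆ L(S_n)`. -/
noncomputable def WSpace (n : ℕ) (A : Finset (Fin n)) : Submodule ℝ (FullWord n → ℝ) :=
  (HSpace n A).map (phi n)

/-- The space `V⁰` of constant functions on `S_n`. -/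
def V0 (n : ℕ) : Submodule ℝ (FullWord n → ℝ) :=
  Submodule.span ℝ {(fun _ => 1 : FullWord n → ℝ)}


noncomputable def insSum (c : Fin n) (l : List (Fin n)) (F : List (Fin n) → ℝ) : ℝ :=
  ∑ i ∈ Finset.range (l.length + 1), F (l.insertIdx i c)

theorem insSum_nil (c : Fin n) (F : List (Fin n) → ℝ) : insSum c [] F = F [c] := by
  simp [insSum]

theorem insSum_cons (c x : Fin n) (l : List (Fin n)) (F : List (Fin n) → ℝ) :
    insSum c (x :: l) F = F (c :: x :: l) + insSum c l (fun m => F (x :: m)) := by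
  unfold insSum
  rw [List.length_cons, Finset.sum_range_succ']
  simp [add_comm]

theorem insSum_append (c x : Fin n) (u v : List (Fin n)) (F : List (Fin n) → ℝ) :
    insSum c (u ++ x :: v) F =
      insSum c u (fun m => F (m ++ x :: v)) + insSum c v (fun m => F (u ++ x :: m)) := by
  induction u generalizing F with
  | nil => simp [insSum_nil, insSum_cons]
  | cons y u ih =>
    rw [List.cons_append, insSum_cons, ih, insSum_cons]
    simp [add_assoc]

theorem insSum_congr (c : Fin n) (l : List (Fin n)) (F G : List (Fin n) → ℝ)
    (h : ∀ u v, l = u ++ v → F (u ++ c :: v) = G (u ++ c :: v)) :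
    insSum c l F = insSum c l G := by
  induction l generalizing F G with
  | nil => simpa [insSum_nil] using h [] [] rfl
  | cons x l ih =>
    rw [insSum_cons, insSum_cons, ih (fun m => F (x :: m)) (fun m => G (x :: m))]
    · have := h [] (x :: l) rfl
      simp at this
      rw [this]
    · intro u v huv
      exact h (x :: u) v (by simp [huv])

theorem insSum_zero (c : Fin n) (l : List (Fin n)) (F : List (Fin n) → ℝ)
    (h : ∀ u v, l = u ++ v → F (u ++ c :: v) = 0) :
    insSum c l F = 0 := by
  rw [insSum_congr c l F (fun _ => 0) h]
  simp [insSum]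

theorem insSum_last (c : Fin n) (l : List (Fin n)) (F : List (Fin n) → ℝ)
    (h : ∀ u v, l = u ++ v → v ≠ [] → F (u ++ c :: v) = 0) :
    insSum c l F = F (l ++ [c]) := by
  induction l generalizing F with
  | nil => simp [insSum_nil]
  | cons x l ih =>
    rw [insSum_cons, ih (fun m => F (x :: m))]
    · have := h [] (x :: l) rfl (by simp)
      simp at this
      simp [this]
    · intro u v huv hv
      exact h (x :: u) v (by simp [huv]) hv

theorem insSum_first (c : Fin n) (l : List (Fin n)) (F : List (Fin n) → ℝ)
    (h : ∀ u v, l = u ++ v → u ≠ [] → F (u ++ c :: v) = 0) :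
    insSum c l F = F (c :: l) := by
  cases l with
  | nil => simp [insSum_nil]
  | cons x l =>
    rw [insSum_cons, insSum_zero c l (fun m => F (x :: m)), add_zero]
    intro u v huv
    exact h (x :: u) v (by simp [huv]) (by simp)

theorem insSum_add (c : Fin n) (l : List (Fin n)) (F G : List (Fin n) → ℝ) :
    insSum c l (F + G) = insSum c l F + insSum c l G := by
  simp [insSum, Finset.sum_add_distrib]

theorem insSum_smul (c : Fin n) (l : List (Fin n)) (r : ℝ) (F : List (Fin n) → ℝ) :
    insSum c l (r • F) = r * insSum c l F := by
  simp [insSum, Finset.mul_sum]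

/-- Functions on words of content `B` killed by deletion of each letter of `C`. -/
def KL (C B : Finset (Fin n)) : Submodule ℝ (List (Fin n) → ℝ) where
  carrier := {Y | (∀ l, ¬ (l.Nodup ∧ l.toFinset = B) → Y l = 0) ∧
    ∀ c ∈ C, ∀ ω : List (Fin n), ω.Nodup → ω.toFinset = B.erase c → insSum c ω Y = 0}
  add_mem' := by
    rintro x y ⟨hx1, hx2⟩ ⟨hy1, hy2⟩
    refine ⟨fun w hw => by simp [hx1 w hw, hy1 w hw], fun a ha ω h1 h2 => ?_⟩
    rw [insSum_add, hx2 a ha ω h1 h2, hy2 a ha ω h1 h2, add_zero]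
  zero_mem' := ⟨fun _ _ => rfl, fun a ha ω _ _ => by simp [insSum]⟩
  smul_mem' := by
    rintro c x ⟨hx1, hx2⟩
    refine ⟨fun w hw => by simp [hx1 w hw], fun a ha ω h1 h2 => ?_⟩
    rw [insSum_smul, hx2 a ha ω h1 h2, mul_zero]

/-- Restriction of a function on lists to injective words. -/
def resL (n : ℕ) : (List (Fin n) → ℝ) →ₗ[ℝ] (InjWord n → ℝ) where
  toFun Y := fun w => Y w.val
  map_add' _ _ := rfl
  map_smul' _ _ := rfl

theorem resL_inj (C B : Finset (Fin n)) :
    Function.Injective ((resL n).comp (KL C B).subtype) := by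
  rw [← LinearMap.ker_eq_bot, LinearMap.ker_eq_bot']
  rintro ⟨Y, hY⟩ h
  ext l
  by_cases hl : l.Nodup
  · exact congrFun h ⟨l, hl⟩
  · exact hY.1 l (fun h' => hl h'.1)

instance finKL (C B : Finset (Fin n)) : Module.Finite ℝ (KL C B) :=
  Module.Finite.of_injective _ (resL_inj C B)

theorem resL_mem (B : Finset (Fin n)) (Y : List (Fin n) → ℝ) (hY : Y ∈ KL B B) :
    resL n Y ∈ HSpace n B := by
  refine ⟨fun w hw => hY.1 _ (fun h => hw h.2), fun a ha ω hω => ?_⟩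
  have := hY.2 a ha ω.val ω.prop hω
  rw [insSum] at this
  rw [← this]
  refine Finset.sum_congr rfl fun i _ => ?_
  have hna : a ∉ ω.val := by
    rw [← List.mem_toFinset]
    change a ∉ content ω
    simp [hω]
  simp [resL, insertAt, hna]

theorem finrank_KL_le (B : Finset (Fin n)) :
    Module.finrank ℝ (KL B B) ≤ Module.finrank ℝ (HSpace n B) := by
  refine LinearMap.finrank_le_finrank_of_injective
    (f := ((resL n).comp (KL B B).subtype).codRestrict (HSpace n B)
      (fun Y => resL_mem B Y.1 Y.2)) ?_
  intro x y h
  exact resL_inj B B (congrArg Subtype.val h)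

open Classical in
noncomputable def sgnAdj (a b : Fin n) (l : List (Fin n)) : ℝ :=
  if ∃ u v, l = u ++ a :: b :: v then 1 else if ∃ u v, l = u ++ b :: a :: v then -1 else 0

theorem nodup_split {a : Fin n} {p q p' q' : List (Fin n)} (h : (p ++ a :: q).Nodup)
    (e : p ++ a :: q = p' ++ a :: q') : p = p' ∧ q = q' := by
  have h1 : a ∉ p := by
    intro hp
    have := List.nodup_append.1 h
    exact this.2.2 a hp a (by simp) rfl
  have h2 : a ∉ q := by
    have := (List.nodup_append.1 h).2.1
    exact (List.nodup_cons.1 this).1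
  have := (List.append_cons_inj_of_notMem h1 h2).1 e
  exact ⟨this.1, this.2.2⟩

theorem sgnAdj_ab (a b : Fin n) (u v : List (Fin n)) : sgnAdj a b (u ++ a :: b :: v) = 1 := by
  unfold sgnAdj
  rw [if_pos ⟨u, v, rfl⟩]

theorem sgnAdj_ba (a b : Fin n) (u v : List (Fin n)) (h : (u ++ b :: a :: v).Nodup) :
    sgnAdj a b (u ++ b :: a :: v) = -1 := by
  unfold sgnAdj
  rw [if_neg, if_pos ⟨u, v, rfl⟩]
  rintro ⟨p, q, e⟩
  have e' : (u ++ [b]) ++ a :: v = p ++ a :: b :: q := by simpa using e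
  have h' : ((u ++ [b]) ++ a :: v).Nodup := by simpa using h
  obtain ⟨e1, e2⟩ := nodup_split h' e'
  subst e2
  have h1 := (List.nodup_append.1 h).2.1
  have := (List.nodup_cons.1 h1).1
  simp at this

theorem sgnAdj_zero (a b : Fin n) (p q : List (Fin n)) (h : (p ++ a :: q).Nodup)
    (h1 : ∀ q', q ≠ b :: q') (h2 : ∀ p', p ≠ p' ++ [b]) : sgnAdj a b (p ++ a :: q) = 0 := by
  unfold sgnAdj
  rw [if_neg, if_neg]
  · rintro ⟨u, v, e⟩
    have e' : p ++ a :: q = (u ++ [b]) ++ a :: v := by simpa using e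
    exact h2 _ (nodup_split h e').1
  · rintro ⟨u, v, e⟩
    exact h1 _ (nodup_split h e).2

theorem sgnAdj_zero' (a b : Fin n) (l : List (Fin n))
    (h1 : ∀ u v, l ≠ u ++ a :: b :: v) (h2 : ∀ u v, l ≠ u ++ b :: a :: v) :
    sgnAdj a b l = 0 := by
  unfold sgnAdj
  rw [if_neg, if_neg]
  · rintro ⟨u, v, e⟩
    exact h2 _ _ e
  · rintro ⟨u, v, e⟩
    exact h1 _ _ e

/-- Substitution of `ab - ba` for the letter `a`. -/
noncomputable def TL (a b : Fin n) : (List (Fin n) → ℝ) →ₗ[ℝ] (List (Fin n) → ℝ) where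
  toFun Y := fun l => sgnAdj a b l * Y (l.erase b)
  map_add' x y := by funext l; simp [mul_add]
  map_smul' c x := by funext l; simp; ring

theorem TL_apply (a b : Fin n) (Y : List (Fin n) → ℝ) (l : List (Fin n)) :
    TL a b Y l = sgnAdj a b l * Y (l.erase b) := rfl

theorem erase_mid {b : Fin n} {u v : List (Fin n)} (h : (u ++ b :: v).Nodup) :
    (u ++ b :: v).erase b = u ++ v := by
  have h1 : b ∉ u := by
    intro hp
    exact (List.nodup_append.1 h).2.2 b hp b (by simp) rfl
  rw [List.erase_append_right _ h1]
  simp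

theorem TL_ab (a b : Fin n) (Y : List (Fin n) → ℝ) (u v : List (Fin n))
    (h : (u ++ a :: b :: v).Nodup) : TL a b Y (u ++ a :: b :: v) = Y (u ++ a :: v) := by
  rw [TL_apply, sgnAdj_ab, one_mul]
  have h' : ((u ++ [a]) ++ b :: v).Nodup := by simpa using h
  have := erase_mid h'
  simp only [List.append_assoc, List.singleton_append] at this
  rw [this]

theorem TL_ba (a b : Fin n) (Y : List (Fin n) → ℝ) (u v : List (Fin n))
    (h : (u ++ b :: a :: v).Nodup) : TL a b Y (u ++ b :: a :: v) = - Y (u ++ a :: v) := by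
  rw [TL_apply, sgnAdj_ba _ _ _ _ h, erase_mid h]
  ring

theorem nodup_ins {c : Fin n} {u v : List (Fin n)} :
    (u ++ c :: v).Nodup ↔ c ∉ u ++ v ∧ (u ++ v).Nodup := by
  rw [List.nodup_middle, List.nodup_cons]

theorem split_of_mem {c : Fin n} {l : List (Fin n)} (h : c ∈ l) : ∃ u v, l = u ++ c :: v :=
  List.append_of_mem h

theorem TL_mem (A : Finset (Fin n)) (a b : Fin n) (hab : a ≠ b) (ha : a ∈ A) (hb : b ∈ A)
    (Y : List (Fin n) → ℝ) (hY : Y ∈ KL ((A.erase b).erase a) (A.erase b)) :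
    TL a b Y ∈ KL A A := by
  constructor
  · intro l hl
    rw [TL_apply]
    by_cases hbl : b ∈ l
    · rw [hY.1, mul_zero]
      rintro ⟨h1, h2⟩
      apply hl
      obtain ⟨u, v, rfl⟩ := split_of_mem hbl
      by_cases hbu : b ∈ u ++ v
      · exfalso
        have : b ∈ ((u ++ b :: v).erase b) := by
          by_cases hu : b ∈ u
          · rw [List.erase_append_left _ hu]; simp
          · rw [List.erase_append_right _ hu]; simpa using hbu
        rw [← List.mem_toFinset, h2] at this
        simp at this
      · have hu : b ∉ u := fun h => hbu (by simp [h])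
        rw [List.erase_append_right _ hu, List.erase_cons_head] at h1 h2
        refine ⟨nodup_ins.2 ⟨hbu, h1⟩, ?_⟩
        rw [← Finset.insert_erase hb, ← h2]
        ext x; simp
    · rw [sgnAdj_zero', zero_mul]
      · rintro u v rfl; simp at hbl
      · rintro u v rfl; simp at hbl
  · intro c hc ω hω hωA
    have hmem : ∀ x, x ∈ ω ↔ x ∈ A.erase c := fun x => by rw [← hωA]; simp
    have hcω : c ∉ ω := by simp [hmem]
    by_cases hcb : c = b
    · subst hcb
      obtain ⟨u, v, rfl⟩ := split_of_mem ((hmem a).2 (by simp [hab, ha]))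
      rw [insSum_append, insSum_last, insSum_first]
      · rw [List.append_assoc, List.singleton_append, TL_ba, TL_ab]
        · ring
        · have : ((u ++ [a]) ++ c :: v).Nodup := nodup_ins.2 ⟨by simpa using hcω, by simpa using hω⟩
          simpa using this
        · exact nodup_ins.2 ⟨hcω, hω⟩
      · rintro u' v' rfl hu'
        have hn : (u ++ a :: (u' ++ c :: v')).Nodup := by
          have : ((u ++ a :: u') ++ c :: v').Nodup :=
            nodup_ins.2 ⟨by simpa using hcω, by simpa using hω⟩
          simpa using this
        rw [TL_apply, sgnAdj_zero _ _ _ _ hn, zero_mul]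
        · intro q' e
          rcases u' with _ | ⟨x, u'⟩
          · simp at hu'
          · simp at e
            simp [e.1] at hcω
        · rintro p' rfl
          simp at hcω
      · rintro u' v' rfl hv'
        have hn : ((u' ++ c :: v') ++ a :: v).Nodup := by
          have : (u' ++ c :: (v' ++ a :: v)).Nodup :=
            nodup_ins.2 ⟨by simpa using hcω, by simpa using hω⟩
          simpa using this
        rw [TL_apply, sgnAdj_zero _ _ _ _ hn, zero_mul]
        · rintro q' rfl
          simp at hcω
        · intro p' e
          rcases List.eq_nil_or_concat v' with rfl | ⟨v'', x, rfl⟩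
          · simp at hv'
          · have e' : (u' ++ c :: v'') ++ [x] = p' ++ [c] := by simpa using e
            have := (List.append_inj' e' rfl).2
            simp at this
            simp [this] at hcω
    by_cases hca : c = a
    · subst hca
      obtain ⟨u, v, rfl⟩ := split_of_mem ((hmem b).2 (by simp [hab.symm, hb]))
      rw [insSum_append, insSum_last, insSum_first]
      · have hn : ((u ++ [b]) ++ c :: v).Nodup :=
          nodup_ins.2 ⟨by simpa using hcω, by simpa using hω⟩
        rw [List.append_assoc, List.singleton_append, TL_ba, TL_ab]
        · ring
        · exact nodup_ins.2 ⟨hcω, hω⟩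
        · simpa using hn
      · rintro u' v' rfl hu'
        have hn : ((u ++ b :: u') ++ c :: v').Nodup :=
          nodup_ins.2 ⟨by simpa using hcω, by simpa using hω⟩
        have e0 : u ++ b :: (u' ++ c :: v') = (u ++ b :: u') ++ c :: v' := by simp
        rw [TL_apply, e0, sgnAdj_zero _ _ _ _ hn, zero_mul]
        · rintro q' rfl
          have := nodup_ins.1 hω
          simp at this
        · intro p' e
          rcases List.eq_nil_or_concat u' with rfl | ⟨v'', x, rfl⟩
          · simp at hu'
          · have e' : (u ++ b :: v'') ++ [x] = p' ++ [b] := by simpa using e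
            have := (List.append_inj' e' rfl).2
            simp at this
            subst this
            have := nodup_ins.1 hω
            simp at this
      · rintro u' v' rfl hv'
        have hn : (u' ++ c :: (v' ++ b :: v)).Nodup :=
          nodup_ins.2 ⟨by simpa using hcω, by simpa using hω⟩
        have e0 : (u' ++ c :: v') ++ b :: v = u' ++ c :: (v' ++ b :: v) := by simp
        rw [TL_apply, e0, sgnAdj_zero _ _ _ _ hn, zero_mul]
        · intro q' e
          rcases v' with _ | ⟨x, v'⟩
          · simp at hv'
          · simp at e
            rw [e.1] at hω
            have := nodup_ins.1 hω
            simp at this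
        · rintro p' rfl
          have := nodup_ins.1 hω
          simp at this
    have hcK : c ∈ (A.erase b).erase a := by simp [hca, hcb, hc]
    have hins : ∀ x y, ω = x ++ y → (x ++ c :: y).Nodup := by
      rintro x y rfl
      exact nodup_ins.2 ⟨hcω, hω⟩
    by_cases h1 : ∃ u v, ω = u ++ a :: b :: v
    · obtain ⟨u, v, rfl⟩ := h1
      have hn : ((u ++ [a]) ++ b :: v).Nodup := by simpa using hω
      have hn' := nodup_ins.1 hn
      have key := hY.2 c hcK (u ++ a :: v) (by simpa using hn'.2) (by
        rw [Finset.erase_right_comm, ← hωA]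
        have := hn'.1
        ext x; simp at this ⊢; grind)
      rw [insSum_append] at key
      rw [insSum_append, insSum_cons]
      rw [insSum_congr c u _ (fun m => Y (m ++ a :: v)),
        insSum_congr c v _ (fun m => Y (u ++ a :: m))]
      · have h0 : TL a b Y (u ++ a :: c :: b :: v) = 0 := by
          have := hins (u ++ [a]) (b :: v) (by simp)
          rw [TL_apply, sgnAdj_zero, zero_mul]
          · simpa using this
          · intro q' e; simp at e; exact hcb e.1
          · rintro p' rfl; simp at hn'
        rw [h0]; linarith
      · rintro x y rfl
        rw [TL_ab]
        have := hins (u ++ a :: b :: x) y (by simp)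
        simpa using this
      · rintro x y rfl
        rw [TL_ab]
        have := hins x (y ++ a :: b :: v) (by simp)
        simpa using this
    by_cases h2 : ∃ u v, ω = u ++ b :: a :: v
    · obtain ⟨u, v, rfl⟩ := h2
      have hn' := nodup_ins.1 hω
      have key := hY.2 c hcK (u ++ a :: v) (by simpa using hn'.2) (by
        rw [Finset.erase_right_comm, ← hωA]
        have := hn'.1
        ext x; simp at this ⊢; grind)
      rw [insSum_append] at key
      rw [insSum_append, insSum_cons]
      rw [insSum_congr c u _ ((-1 : ℝ) • (fun m => Y (m ++ a :: v))),
        insSum_congr c v _ ((-1 : ℝ) • (fun m => Y (u ++ a :: m))), insSum_smul, insSum_smul]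
      · have h0 : TL a b Y (u ++ b :: c :: a :: v) = 0 := by
          have := hins (u ++ [b]) (a :: v) (by simp)
          have e0 : u ++ b :: c :: a :: v = (u ++ [b, c]) ++ a :: v := by simp
          rw [TL_apply, e0, sgnAdj_zero, zero_mul]
          · simpa using this
          · rintro q' rfl; simp at hn'
          · intro p' e
            have e' : (u ++ [b]) ++ [c] = p' ++ [b] := by simpa using e
            have := (List.append_inj' e' rfl).2
            simp at this
            exact hcb this
        rw [h0]; linarith
      · rintro x y rfl
        rw [TL_ba]
        · simp
        have := hins (u ++ b :: a :: x) y (by simp)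
        simpa using this
      · rintro x y rfl
        rw [TL_ba]
        · simp
        have := hins x (y ++ b :: a :: v) (by simp)
        simpa using this
    apply insSum_zero
    rintro x y rfl
    have hxy := erase_mid (hins x y rfl)
    rw [TL_apply, sgnAdj_zero', zero_mul]
    · intro u v e
      apply h1
      rw [e] at hxy
      rw [← hxy]
      by_cases hu : c ∈ u
      · exact ⟨u.erase c, v, by rw [List.erase_append_left _ hu]⟩
      · refine ⟨u, v.erase c, ?_⟩
        rw [List.erase_append_right _ hu, List.erase_cons_tail, List.erase_cons_tail]
        · simpa using Ne.symm hcb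
        · simpa using Ne.symm hca
    · intro u v e
      apply h2
      rw [e] at hxy
      rw [← hxy]
      by_cases hu : c ∈ u
      · exact ⟨u.erase c, v, by rw [List.erase_append_left _ hu]⟩
      · refine ⟨u, v.erase c, ?_⟩
        rw [List.erase_append_right _ hu, List.erase_cons_tail, List.erase_cons_tail]
        · simpa using Ne.symm hca
        · simpa using Ne.symm hcb

/-- Appending the letter `a` at the end. -/
def RL (a : Fin n) : (List (Fin n) → ℝ) →ₗ[ℝ] (List (Fin n) → ℝ) where
  toFun Z := fun l => if l.getLast? = some a then Z l.dropLast else 0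
  map_add' x y := by funext l; by_cases h : l.getLast? = some a <;> simp [h]
  map_smul' c x := by funext l; by_cases h : l.getLast? = some a <;> simp [h]

theorem RL_snoc (a : Fin n) (Z : List (Fin n) → ℝ) (u : List (Fin n)) :
    RL a Z (u ++ [a]) = Z u := by
  simp [RL]

theorem RL_zero (a : Fin n) (Z : List (Fin n) → ℝ) (l : List (Fin n))
    (h : ∀ u, l ≠ u ++ [a]) : RL a Z l = 0 := by
  have : l.getLast? ≠ some a := by
    intro h'
    rcases List.eq_nil_or_concat l with rfl | ⟨u, x, rfl⟩
    · simp at h'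
    · simp at h'
      subst h'
      exact h u (by simp)
  simp [RL, this]

theorem RL_mem (B : Finset (Fin n)) (a : Fin n) (ha : a ∈ B) (Z : List (Fin n) → ℝ)
    (hZ : Z ∈ KL (B.erase a) (B.erase a)) : RL a Z ∈ KL (B.erase a) B := by
  constructor
  · intro l hl
    by_cases h : ∃ u, l = u ++ [a]
    · obtain ⟨u, rfl⟩ := h
      rw [RL_snoc, hZ.1]
      rintro ⟨h1, h2⟩
      apply hl
      have hau : a ∉ u := by rw [← List.mem_toFinset, h2]; simp
      refine ⟨nodup_ins.2 ⟨by simpa using hau, by simpa using h1⟩, ?_⟩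
      rw [← Finset.insert_erase ha, ← h2]
      ext x; simp
    · push Not at h
      exact RL_zero _ _ _ h
  · intro c hc ω hω hωB
    have hmem : ∀ x, x ∈ ω ↔ x ∈ B.erase c := fun x => by rw [← hωB]; simp
    have hcω : c ∉ ω := by simp [hmem]
    have hca : c ≠ a := (Finset.mem_erase.1 hc).1
    by_cases h : ∃ u, ω = u ++ [a]
    · obtain ⟨u, rfl⟩ := h
      have hn := nodup_ins.1 hω
      have h0 : RL a Z (u ++ [a, c]) = 0 := by
        apply RL_zero
        intro p e
        have e' : (u ++ [a]) ++ [c] = p ++ [a] := by simpa using e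
        have := (List.append_inj' e' rfl).2
        simp at this
        exact hca this
      rw [insSum_append, insSum_nil, h0, add_zero,
        insSum_congr c u _ Z (fun x y _ => RL_snoc _ _ _)]
      apply hZ.2 c hc u (by simpa using hn.2)
      rw [Finset.erase_right_comm, ← hωB]
      have := hn.1
      ext x; simp at this ⊢; grind
    · apply insSum_zero
      rintro x y rfl
      apply RL_zero
      intro p e
      rcases List.eq_nil_or_concat y with rfl | ⟨y', z, rfl⟩
      · have := (List.append_inj' e rfl).2
        simp at this
        exact hca this
      · have e' : (x ++ c :: y') ++ [z] = p ++ [a] := by simpa using e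
        have := (List.append_inj' e' rfl).2
        simp at this
        subst this
        exact h ⟨x ++ y', by simp⟩

theorem KL_mono {C C' B : Finset (Fin n)} (h : C ⊆ C') : KL C' B ≤ KL C B :=
  fun _ hY => ⟨hY.1, fun c hc => hY.2 c (h hc)⟩

/-- An element of `KL B B` vanishing on words not ending in `a` is zero. -/
theorem KL_eq_zero {B : Finset (Fin n)} {a : Fin n} (ha : a ∈ B) {Y : List (Fin n) → ℝ}
    (hY : Y ∈ KL B B)
    (h : ∀ u v, v ≠ [] → (u ++ a :: v).Nodup → Y (u ++ a :: v) = 0) : Y = 0 := by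
  funext l
  by_cases hl : l.Nodup ∧ l.toFinset = B
  · have hal : a ∈ l := by rw [← List.mem_toFinset, hl.2]; exact ha
    obtain ⟨u, v, rfl⟩ := split_of_mem hal
    by_cases hv : v = []
    · subst hv
      have hn := nodup_ins.1 hl.1
      have := hY.2 a ha u (by simpa using hn.2) (by
        rw [← hl.2]
        have := hn.1
        ext x; simp at this ⊢; grind)
      rw [insSum_last] at this
      · exact this
      · rintro x y rfl hy
        apply h _ _ hy
        exact nodup_ins.2 (by simpa using hn)
    · exact h u v hv hl.1
  · exact hY.1 l hl

theorem finrank_KL_pair (B : Finset (Fin n)) (a : Fin n) (ha : a ∈ B) :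
    Module.finrank ℝ (KL B B) + Module.finrank ℝ (KL (B.erase a) (B.erase a)) ≤
      Module.finrank ℝ (KL (B.erase a) B) := by
  rw [← Module.finrank_prod]
  let f : (KL B B × KL (B.erase a) (B.erase a)) →ₗ[ℝ] (List (Fin n) → ℝ) :=
    (KL B B).subtype.coprod ((RL a).comp (KL (B.erase a) (B.erase a)).subtype)
  have hf : ∀ p, f p ∈ KL (B.erase a) B := by
    rintro ⟨y, z⟩
    exact Submodule.add_mem _ (KL_mono (Finset.erase_subset _ _) y.2) (RL_mem B a ha z.1 z.2)
  refine LinearMap.finrank_le_finrank_of_injective (f := f.codRestrict _ hf) ?_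
  rw [← LinearMap.ker_eq_bot, LinearMap.ker_eq_bot']
  rintro ⟨⟨y, hy⟩, ⟨z, hz⟩⟩ h
  have h' : ∀ l, y l + RL a z l = 0 := fun l => congrFun (congrArg Subtype.val h) l
  have hy0 : y = 0 := by
    refine KL_eq_zero ha hy ?_
    intro u v hv hn
    have := h' (u ++ a :: v)
    rwa [RL_zero, add_zero] at this
    intro p e
    exact hv (nodup_split hn e).2
  have hz0 : z = 0 := by
    funext u
    have := h' (u ++ [a])
    rwa [RL_snoc, hy0, Pi.zero_apply, zero_add] at this
  subst hy0 hz0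
  rfl

theorem finrank_KL_sum (A : Finset (Fin n)) (a : Fin n) (ha : a ∈ A) :
    ∑ b : ↥(A.erase a), Module.finrank ℝ (KL ((A.erase b.1).erase a) (A.erase b.1)) ≤
      Module.finrank ℝ (KL A A) := by
  rw [← Module.finrank_pi_fintype ℝ]
  let f : ((b : ↥(A.erase a)) → KL ((A.erase b.1).erase a) (A.erase b.1)) →ₗ[ℝ]
      (List (Fin n) → ℝ) :=
    ∑ b : ↥(A.erase a), ((TL a b.1).comp (Submodule.subtype _)).comp (LinearMap.proj b)
  have hfa : ∀ y l, f y l = ∑ b : ↥(A.erase a), TL a b.1 (y b).1 l := by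
    intro y l
    simp [f, LinearMap.sum_apply, Finset.sum_apply]
  have hf : ∀ y, f y ∈ KL A A := by
    intro y
    have : f y = ∑ b : ↥(A.erase a), TL a b.1 (y b).1 := by
      funext l; rw [hfa, Finset.sum_apply]
    rw [this]
    refine Submodule.sum_mem _ fun b _ => ?_
    have hb := Finset.mem_erase.1 b.2
    exact TL_mem A a b.1 hb.1.symm ha hb.2 _ (y b).2
  refine LinearMap.finrank_le_finrank_of_injective (f := f.codRestrict _ hf) ?_
  rw [← LinearMap.ker_eq_bot, LinearMap.ker_eq_bot']
  intro y h
  have h' : ∀ l, ∑ b : ↥(A.erase a), TL a b.1 (y b).1 l = 0 := fun l => by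
    rw [← hfa]; exact congrFun (congrArg Subtype.val h) l
  have key : ∀ k : ℕ, ∀ u : List (Fin n), u.length = k → ∀ (b : ↥(A.erase a)) (v : List (Fin n)),
      (u ++ a :: v).Nodup → (u ++ a :: v).toFinset = A.erase b.1 →
      (y b).1 (u ++ a :: v) = 0 := by
    intro k
    induction k with
    | zero => 
      intro u hu b v hn hc
      obtain rfl := List.length_eq_zero_iff.1 hu
      have hb := Finset.mem_erase.1 b.2
      have hbw : b.1 ∉ ([] ++ a :: v) := by rw [← List.mem_toFinset, hc]; simp
      have hn' : ([] ++ a :: b.1 :: v).Nodup := by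
        have : ([a] ++ b.1 :: v).Nodup := nodup_ins.2 ⟨by simpa using hbw, by simpa using hn⟩
        simpa using this
      have := h' ([] ++ a :: b.1 :: v)
      rw [Finset.sum_eq_single b] at this
      · rwa [TL_ab _ _ _ _ _ hn'] at this
      · intro c _ hcb
        rw [TL_apply, sgnAdj_zero _ _ _ _ hn', zero_mul]
        · intro q' e
          simp at e
          exact hcb e.1.symm
        · simp
      · simp
    | succ k ih =>
      intro u hu b v hn hc
      have hb := Finset.mem_erase.1 b.2
      have hbw : b.1 ∉ (u ++ a :: v) := by rw [← List.mem_toFinset, hc]; simp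
      have hn' : (u ++ a :: b.1 :: v).Nodup := by
        have : ((u ++ [a]) ++ b.1 :: v).Nodup :=
          nodup_ins.2 ⟨by simpa using hbw, by simpa using hn⟩
        simpa using this
      have := h' (u ++ a :: b.1 :: v)
      rw [Finset.sum_eq_single b] at this
      · rwa [TL_ab _ _ _ _ _ hn'] at this
      · intro c _ hcb
        by_cases hlast : ∃ u', u = u' ++ [c.1]
        · obtain ⟨u', rfl⟩ := hlast
          have hn2 : (u' ++ c.1 :: a :: b.1 :: v).Nodup := by simpa using hn'
          have e0 : (u' ++ [c.1]) ++ a :: b.1 :: v = u' ++ c.1 :: a :: b.1 :: v := by simp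
          rw [e0, TL_ba _ _ _ _ _ hn2, ih u' (by simpa using hu) c (b.1 :: v), neg_zero]
          · exact (nodup_ins.1 hn2).2
          · have h3 := (nodup_ins.1 hn2).1
            ext x
            have hx : x ∈ (u' ++ [c.1] ++ a :: v).toFinset ↔ x ∈ A.erase b.1 := by rw [hc]
            have hbA := hb.2
            simp only [List.mem_toFinset, List.mem_append, List.mem_cons, List.not_mem_nil,
              or_false, Finset.mem_erase] at h3 hx ⊢
            by_cases hxb : x = b.1
            · subst hxb
              constructor
              · intro _
                exact ⟨fun e => hcb (Subtype.ext e.symm), hbA⟩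
              · intro _
                exact Or.inr (Or.inr (Or.inl rfl))
            · grind
        · rw [TL_apply, sgnAdj_zero _ _ _ _ hn', zero_mul]
          · intro q' e
            simp at e
            exact hcb e.1.symm
          · intro p' e
            exact hlast ⟨p', e⟩
      · simp
  funext b
  ext l
  by_cases hl : l.Nodup ∧ l.toFinset = A.erase b.1
  · have hal : a ∈ l := by
      rw [← List.mem_toFinset, hl.2]
      simp [ha, (Finset.mem_erase.1 b.2).1.symm]
    obtain ⟨u, v, rfl⟩ := split_of_mem hal
    exact key _ u rfl b v hl.1 hl.2
  · exact (y b).2.1 l hl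

theorem numDerangements_le_KL : ∀ (k : ℕ) (A : Finset (Fin n)), A.card = k →
    numDerangements k ≤ Module.finrank ℝ (KL A A)
  | 0, A, hA => by
    obtain rfl := Finset.card_eq_zero.1 hA
    rw [numDerangements_zero, Nat.one_le_iff_ne_zero, ← Nat.pos_iff_ne_zero,
      Module.finrank_pos_iff_exists_ne_zero]
    refine ⟨⟨fun l => if l = [] then 1 else 0, ?_, by simp⟩, ?_⟩
    · intro l hl
      have : l ≠ [] := by
        rintro rfl
        simp at hl
      simp [this]
    · intro h
      have := congrFun (congrArg Subtype.val h) []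
      simp at this
  | 1, A, hA => by simp
  | (k+2), A, hA => by
    obtain ⟨a, ha⟩ : A.Nonempty := Finset.card_pos.1 (by omega)
    refine le_trans ?_ (finrank_KL_sum A a ha)
    have h1 : ∀ b : ↥(A.erase a), numDerangements k + numDerangements (k+1) ≤
        Module.finrank ℝ (KL ((A.erase b.1).erase a) (A.erase b.1)) := by
      intro b
      have hb := Finset.mem_erase.1 b.2
      have hab : a ∈ A.erase b.1 := by simp [ha, hb.1.symm]
      have c1 : (A.erase b.1).card = k + 1 := by
        rw [Finset.card_erase_of_mem hb.2, hA]; rfl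
      have c2 : ((A.erase b.1).erase a).card = k := by
        rw [Finset.card_erase_of_mem hab, c1]; rfl
      have := finrank_KL_pair (A.erase b.1) a hab
      have i1 := numDerangements_le_KL (k+1) _ c1
      have i2 := numDerangements_le_KL k _ c2
      omega
    refine le_trans ?_ (Finset.sum_le_sum fun b _ => h1 b)
    rw [numDerangements_add_two, Finset.sum_const, Finset.card_univ, Fintype.card_coe,
      Finset.card_erase_of_mem ha, hA]
    simp

theorem numDerangements_le_HSpace (A : Finset (Fin n)) :
    numDerangements A.card ≤ Module.finrank ℝ (HSpace n A) :=
  (numDerangements_le_KL _ A rfl).trans (finrank_KL_le A)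

theorem sum_numDerangements (n : ℕ) :
    ∑ A : Finset (Fin n), numDerangements A.card = n.factorial := by
  have h0 : Fintype.card (Equiv.Perm (Fin n)) = n.factorial := by
    rw [Fintype.card_perm, Fintype.card_fin]
  rw [← h0, ← Finset.card_univ,
    Finset.card_eq_sum_card_fiberwise (f := fun σ : Equiv.Perm (Fin n) => σ.support)
      (t := Finset.univ) (by simp)]
  refine Finset.sum_congr rfl fun A _ => ?_
  have h1 := Fintype.card_congr (derangements.subtypeEquiv (fun x : Fin n => x ∈ A))
  rw [card_derangements_eq_numDerangements] at h1
  have h2 : Fintype.card {x : Fin n // x ∈ A} = A.card := by simp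
  rw [h2] at h1
  rw [h1, Fintype.card_subtype]
  congr 1
  ext σ
  simp only [Finset.mem_filter, Finset.mem_univ, true_and]
  rw [Finset.ext_iff]
  refine forall_congr' fun x => ?_
  rw [Equiv.Perm.mem_support, Function.mem_fixedPoints, Function.IsFixedPt]
  tauto

theorem card_fullWord_le (n : ℕ) : Fintype.card (FullWord n) ≤ n.factorial := by
  have : n.factorial = ((List.finRange n).permutations.toFinset).card := by
    rw [List.toFinset_card_of_nodup (List.nodup_permutations _ (List.nodup_finRange n)),
      List.length_permutations, List.length_finRange]
  rw [this, ← Finset.card_univ]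
  refine Finset.card_le_card_of_injOn (fun w => w.1.1) ?_ ?_
  · intro w _
    have h2 : w.1.1.toFinset = Finset.univ := w.2
    simp only [List.coe_toFinset, List.mem_permutations, Set.mem_ofPred_eq]
    rw [List.perm_ext_iff_of_nodup w.1.2 (List.nodup_finRange n)]
    intro a
    rw [← List.mem_toFinset, h2]
    simp
  · intro w _ w' _ h
    exact Subtype.ext (Subtype.ext h)

/-- Number of full words restricting to `π` and containing `ω`. -/
noncomputable def cnt (B : Finset (Fin n)) (π ω : InjWord n) : ℕ :=
  (Finset.univ.filter (fun σ : FullWord n =>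
    restrict B σ.val = π ∧ ω.val <:+: σ.val.val)).card

theorem marginal_phi (B : Finset (Fin n)) (x : InjWord n → ℝ) (π : InjWord n) :
    marginal n B (phi n x) π = ∑ ω, (cnt B π ω : ℝ) * x ω := by
  change ∑ σ ∈ Finset.univ.filter (fun σ : FullWord n => restrict B σ.val = π),
    ∑ ω ∈ Finset.univ.filter (fun ω : InjWord n => ω.val <:+: σ.val.val), x ω = _
  simp only [cnt, ← nsmul_eq_mul, ← Finset.sum_const]
  apply Finset.sum_comm'
  simp

theorem filter_eq_self_mid {B : Finset (Fin n)} {u v w : List (Fin n)} (h : (u ++ w ++ v).Nodup)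
    (hw : w.toFinset = B) : (u ++ w ++ v).filter (fun a => a ∈ B) = w := by
  subst hw
  have hd := List.nodup_append.1 h
  have hd2 := List.nodup_append.1 hd.1
  rw [List.filter_append, List.filter_append, List.filter_eq_nil_iff.2, List.filter_eq_self.2,
    List.filter_eq_nil_iff.2]
  · simp
  · intro a ha
    simp
    intro h'
    exact hd.2.2 a (by simp [h']) a ha rfl
  · simp
  · intro a ha
    simp
    intro h'
    exact hd2.2.2 a ha a h' rfl

theorem cnt_eq_zero (B : Finset (Fin n)) (π ω : InjWord n) (h : content ω = B) (hne : ω ≠ π) :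
    cnt B π ω = 0 := by
  rw [cnt, Finset.card_eq_zero, Finset.filter_eq_empty_iff]
  rintro ⟨⟨σ, h1⟩, h2⟩ _ ⟨h3, u, v, e⟩
  apply hne
  rw [← h3]
  apply Subtype.ext
  simp only at e
  subst e
  exact (filter_eq_self_mid h1 h).symm

theorem cnt_pos (B : Finset (Fin n)) (π : InjWord n) (h : content π = B) :
    cnt B π π ≠ 0 := by
  rw [cnt, Finset.card_ne_zero]
  have hd : (π.val ++ (Finset.univ \ B).toList).Nodup := by
    rw [List.nodup_append]
    refine ⟨π.prop, Finset.nodup_toList _, ?_⟩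
    rintro a ha _ hb rfl
    have : a ∈ content π := by simpa [content] using ha
    rw [h] at this
    simp [this] at hb
  refine ⟨⟨⟨π.val ++ (Finset.univ \ B).toList, hd⟩, ?_⟩, ?_⟩
  · change (π.val ++ (Finset.univ \ B).toList).toFinset = Finset.univ
    rw [List.toFinset_append, Finset.toList_toFinset]
    change content π ∪ _ = _
    rw [h]; simp
  · simp only [Finset.mem_filter, Finset.mem_univ, true_and]
    refine ⟨Subtype.ext ?_, [], (Finset.univ \ B).toList, by simp⟩
    have := filter_eq_self_mid (u := []) (w := π.val) (v := (Finset.univ \ B).toList) (B := B)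
      (by simpa using hd) h
    simpa [restrict] using this

theorem marginal_self (B : Finset (Fin n)) (x : InjWord n → ℝ) (hx : x ∈ HSpace n B)
    (h : marginal n B (phi n x) = 0) : x = 0 := by
  funext π
  by_cases hπ : content π = B
  · have := congrFun h π
    rw [marginal_phi, Finset.sum_eq_single π] at this
    · simpa [cnt_pos B π hπ] using this
    · intro ω _ hne
      by_cases hω : content ω = B
      · rw [cnt_eq_zero B π ω hω hne]; simp
      · rw [hx.1 ω hω, mul_zero]
    · simp
  · exact hx.1 π hπ

theorem cnt_eq_pairs (B : Finset (Fin n)) (π ω : InjWord n) (hne : ω.val ≠ []) :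
    cnt B π ω = (Finset.univ.filter (fun p : InjWord n × InjWord n =>
      (p.1.val ++ ω.val ++ p.2.val).Nodup ∧
      (p.1.val ++ ω.val ++ p.2.val).toFinset = Finset.univ ∧
      (p.1.val ++ ω.val ++ p.2.val).filter (fun a => a ∈ B) = π.val)).card := by
  symm
  refine Finset.card_bij (fun p hp => ⟨⟨p.1.val ++ ω.val ++ p.2.val,
    (Finset.mem_filter.1 hp).2.1⟩, (Finset.mem_filter.1 hp).2.2.1⟩) ?_ ?_ ?_
  · intro p hp
    have := (Finset.mem_filter.1 hp).2
    simp only [Finset.mem_filter, Finset.mem_univ, true_and]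
    exact ⟨Subtype.ext this.2.2, p.1.val, p.2.val, rfl⟩
  · intro p hp q hq e
    have e' : p.1.val ++ ω.val ++ p.2.val = q.1.val ++ ω.val ++ q.2.val :=
      congrArg (fun s : FullWord n => s.1.1) e
    have hp' := (Finset.mem_filter.1 hp).2.1
    obtain ⟨c, t, hct⟩ := List.exists_cons_of_ne_nil hne
    rw [hct] at e' hp'
    simp only [List.append_assoc, List.cons_append] at e' hp'
    obtain ⟨e1, e2⟩ := nodup_split hp' e'
    exact Prod.ext (Subtype.ext e1) (Subtype.ext (List.append_cancel_left e2))
  · rintro ⟨⟨σ, h1⟩, h2⟩ hσ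
    obtain ⟨h3, u, v, e⟩ := (Finset.mem_filter.1 hσ).2
    simp only at e
    subst e
    have hd := List.nodup_append.1 h1
    have hd2 := List.nodup_append.1 hd.1
    refine ⟨(⟨u, hd2.1⟩, ⟨v, hd.2.1⟩), ?_, rfl⟩
    simp only [Finset.mem_filter, Finset.mem_univ, true_and]
    exact ⟨h1, h2, congrArg Subtype.val h3⟩

theorem filter_erase_eq {B : Finset (Fin n)} {a : Fin n} (ha : a ∉ B) (l : List (Fin n)) :
    l.filter (fun x => x ∈ B) = (l.erase a).filter (fun x => x ∈ B) := by
  induction l with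
  | nil => rfl
  | cons x l ih =>
    by_cases hx : x = a
    · subst hx; simp [ha]
    · rw [List.erase_cons_tail (by simpa using hx), List.filter_cons, List.filter_cons, ih]

theorem cnt_congr (B : Finset (Fin n)) (a : Fin n) (ha : a ∉ B) (π ω ω' : InjWord n)
    (h1 : a ∈ ω.val) (h2 : a ∈ ω'.val) (h : ω.val.erase a = ω'.val.erase a) :
    cnt B π ω = cnt B π ω' := by
  have hp : List.Perm ω.val ω'.val :=
    (List.perm_cons_erase h1).trans (h ▸ (List.perm_cons_erase h2).symm)
  have hf : ω.val.filter (fun x => x ∈ B) = ω'.val.filter (fun x => x ∈ B) := by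
    rw [filter_erase_eq ha, h, ← filter_erase_eq ha]
  rw [cnt_eq_pairs _ _ _ (List.ne_nil_of_mem h1), cnt_eq_pairs _ _ _ (List.ne_nil_of_mem h2)]
  congr 1
  ext p
  simp only [Finset.mem_filter, Finset.mem_univ, true_and]
  have hpp : List.Perm (p.1.val ++ ω.val ++ p.2.val) (p.1.val ++ ω'.val ++ p.2.val) :=
    (hp.append_left _).append_right _
  rw [hpp.nodup_iff, List.toFinset_eq_of_perm _ _ hpp, List.filter_append, List.filter_append, hf,
    ← List.filter_append, ← List.filter_append]

theorem insertIdx_take_drop : ∀ (i : ℕ) (a : Fin n) (l : List (Fin n)), i ≤ l.length →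
    l.insertIdx i a = l.take i ++ a :: l.drop i
  | 0, a, l, _ => by simp
  | (i+1), a, [], h => by simp at h
  | (i+1), a, (x :: l), h => by
      rw [List.insertIdx_succ_cons, insertIdx_take_drop i a l (by simpa using h)]
      simp

theorem fiber_sum (A : Finset (Fin n)) (a : Fin n) (ha : a ∈ A) (x : InjWord n → ℝ)
    (hx : x ∈ HSpace n A) (ω' : InjWord n) (hω' : content ω' = A.erase a) :
    ∑ ω ∈ Finset.univ.filter (fun ω : InjWord n => content ω = A ∧ ω.val.erase a = ω'.val), x ω
      = 0 := by
  have hna : a ∉ ω'.val := by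
    rw [← List.mem_toFinset]
    change a ∉ content ω'
    simp [hω']
  rw [← hx.2 a ha ω' hω']
  symm
  have hv : ∀ i, (insertAt ω' i a).val = ω'.val.insertIdx i a := by
    intro i; simp [insertAt, hna]
  have hins : ∀ i ≤ ω'.val.length, ω'.val.insertIdx i a = ω'.val.take i ++ a :: ω'.val.drop i := by
    intro i hi
    exact insertIdx_take_drop i a _ hi
  refine Finset.sum_bij (fun i _ => insertAt ω' i a) ?_ ?_ (fun _ _ => ?_) (fun _ _ => rfl)
  · intro i hi
    have hi' : i ≤ ω'.val.length := by simpa [Nat.lt_succ_iff] using hi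
    simp only [Finset.mem_filter, Finset.mem_univ, true_and, hv]
    constructor
    · change (insertAt ω' i a).val.toFinset = A
      rw [hv, List.toFinset_eq_of_perm _ _ (perm_insertIdx i a _ hi'), List.toFinset_cons]
      change insert a (content ω') = A
      rw [hω', Finset.insert_erase ha]
    · have hn := (insertAt ω' i a).prop
      rw [hv, hins i hi'] at hn
      rw [hins i hi', erase_mid hn, List.take_append_drop]
  · intro i hi j hj e
    have hi' : i ≤ ω'.val.length := by simpa [Nat.lt_succ_iff] using hi
    have hj' : j ≤ ω'.val.length := by simpa [Nat.lt_succ_iff] using hj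
    have hn := (insertAt ω' i a).prop
    have e' := congrArg Subtype.val e
    simp only [hv] at e' hn
    rw [hins i hi'] at e' hn
    rw [hins j hj'] at e'
    have := congrArg List.length (nodup_split hn e').1
    simpa [hi', hj'] using this
  · rename_i ω hω
    obtain ⟨h1, h2⟩ := (Finset.mem_filter.1 hω).2
    have haω : a ∈ ω.val := by
      rw [← List.mem_toFinset]
      change a ∈ content ω
      rw [h1]; exact ha
    obtain ⟨u, v, e⟩ := split_of_mem haω
    have hn : (u ++ a :: v).Nodup := e ▸ ω.prop
    rw [e, erase_mid hn] at h2
    refine ⟨u.length, ?_, ?_⟩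
    · rw [← h2]; simp
    · apply Subtype.ext
      rw [hv, hins, e, ← h2]
      · simp
      · rw [← h2]; simp

theorem marginal_other (A B : Finset (Fin n)) (hAB : ¬ A ⊆ B) (x : InjWord n → ℝ)
    (hx : x ∈ HSpace n A) : marginal n B (phi n x) = 0 := by
  obtain ⟨a, ha, haB⟩ := Finset.not_subset.1 hAB
  funext π
  rw [marginal_phi]
  have e1 : ∑ ω, (cnt B π ω : ℝ) * x ω =
      ∑ ω ∈ Finset.univ.filter (fun ω : InjWord n => content ω = A), (cnt B π ω : ℝ) * x ω := by
    symm
    apply Finset.sum_subset (Finset.filter_subset _ _)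
    intro ω _ hω
    rw [hx.1 ω (by simpa using hω), mul_zero]
  rw [e1, ← Finset.sum_fiberwise_of_maps_to
    (g := fun ω : InjWord n => (⟨ω.val.erase a, ω.prop.erase a⟩ : InjWord n))
    (t := Finset.univ) (by simp)]
  apply Finset.sum_eq_zero
  intro ω' _
  rw [Finset.filter_filter]
  by_cases hne : (Finset.univ.filter (fun ω : InjWord n => content ω = A ∧
    (⟨ω.val.erase a, ω.prop.erase a⟩ : InjWord n) = ω')).Nonempty
  · obtain ⟨ω0, h0⟩ := hne
    obtain ⟨h1, h2⟩ := (Finset.mem_filter.1 h0).2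
    have hmem : ∀ ω : InjWord n, content ω = A → a ∈ ω.val := by
      intro ω h
      rw [← List.mem_toFinset]
      change a ∈ content ω
      rw [h]; exact ha
    have e2 : ∀ ω ∈ Finset.univ.filter (fun ω : InjWord n => content ω = A ∧
        (⟨ω.val.erase a, ω.prop.erase a⟩ : InjWord n) = ω'),
        (cnt B π ω : ℝ) * x ω = (cnt B π ω0 : ℝ) * x ω := by
      intro ω hω
      obtain ⟨h3, h4⟩ := (Finset.mem_filter.1 hω).2
      rw [cnt_congr B a haB π ω ω0 (hmem _ h3) (hmem _ h1)
        (congrArg Subtype.val (h4.trans h2.symm))]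
    rw [Finset.sum_congr rfl e2, ← Finset.mul_sum]
    have := fiber_sum A a ha x hx ω' (by
      rw [← h2, ← h1]
      ext y
      simp [content, ω0.prop.mem_erase_iff])
    simp only [Subtype.ext_iff]
    rw [this, mul_zero]
  · rw [Finset.not_nonempty_iff_eq_empty.1 hne, Finset.sum_empty]

theorem indep (x : (A : Finset (Fin n)) → InjWord n → ℝ) (hx : ∀ A, x A ∈ HSpace n A)
    (h : ∑ A, phi n (x A) = 0) : ∀ A, x A = 0 := by
  intro A
  induction A using Finset.strongInduction with
  | H B ih =>
    apply marginal_self B (x B) (hx B)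
    have := congrArg (marginal n B) h
    rw [map_sum, map_zero, Finset.sum_eq_single B] at this
    · exact this
    · intro A _ hAB
      by_cases hs : A ⊆ B
      · rw [ih A (Finset.ssubset_iff_subset_ne.2 ⟨hs, hAB⟩)]; simp
      · exact marginal_other A B hs _ (hx A)
    · simp

/-- The total synthesis map. -/
noncomputable def bigPhi (n : ℕ) :
    ((A : Finset (Fin n)) → HSpace n A) →ₗ[ℝ] (FullWord n → ℝ) :=
  ∑ A, ((phi n).comp (HSpace n A).subtype).comp (LinearMap.proj A)

theorem bigPhi_apply (x : (A : Finset (Fin n)) → HSpace n A) :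
    bigPhi n x = ∑ A, phi n (x A).1 := by
  simp [bigPhi, LinearMap.sum_apply]

theorem bigPhi_inj (n : ℕ) : Function.Injective (bigPhi n) := by
  rw [← LinearMap.ker_eq_bot, LinearMap.ker_eq_bot']
  intro x h
  rw [bigPhi_apply] at h
  funext A
  exact Subtype.ext (indep (fun A => (x A).1) (fun A => (x A).2) h A)

theorem sum_finrank_le (n : ℕ) :
    ∑ A : Finset (Fin n), Module.finrank ℝ (HSpace n A) ≤ Fintype.card (FullWord n) := by
  rw [← Module.finrank_pi_fintype ℝ, ← Module.finrank_fintype_fun_eq_card ℝ]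
  exact LinearMap.finrank_le_finrank_of_injective (bigPhi_inj n)

theorem finrank_HSpace (A : Finset (Fin n)) :
    Module.finrank ℝ (HSpace n A) = numDerangements A.card := by
  have h1 : ∑ A : Finset (Fin n), numDerangements A.card =
      ∑ A : Finset (Fin n), Module.finrank ℝ (HSpace n A) := by
    apply le_antisymm
    · exact Finset.sum_le_sum fun A _ => numDerangements_le_HSpace A
    · rw [sum_numDerangements]
      exact (sum_finrank_le n).trans (card_fullWord_le n)
  exact ((Finset.sum_eq_sum_iff_of_le (fun A _ => numDerangements_le_HSpace A)).1 h1 A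
    (Finset.mem_univ A)).symm

theorem bigPhi_surj (n : ℕ) : Function.Surjective (bigPhi n) := by
  have hd : Module.finrank ℝ ((A : Finset (Fin n)) → HSpace n A) =
      Module.finrank ℝ (FullWord n → ℝ) := by
    apply le_antisymm (LinearMap.finrank_le_finrank_of_injective (bigPhi_inj n))
    rw [Module.finrank_fintype_fun_eq_card ℝ, Module.finrank_pi_fintype ℝ]
    simp only [finrank_HSpace]
    rw [sum_numDerangements]
    exact card_fullWord_le n
  exact (LinearMap.injective_iff_surjective_of_finrank_eq_finrank hd).1 (bigPhi_inj n)

theorem phi_nil (x : InjWord n → ℝ) (hx : x ∈ HSpace n ∅) :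
    phi n x = fun _ => x ⟨[], List.nodup_nil⟩ := by
  funext σ
  change ∑ ω ∈ Finset.univ.filter (fun ω : InjWord n => ω.val <:+: σ.val.val), x ω = _
  rw [Finset.sum_eq_single ⟨[], List.nodup_nil⟩]
  · intro ω _ hω
    apply hx.1
    intro h
    apply hω
    apply Subtype.ext
    exact List.toFinset_eq_empty_iff _ |>.1 h
  · intro h
    simp at h

theorem WSpace_empty : WSpace n ∅ = V0 n := by
  apply le_antisymm
  · rintro _ ⟨x, hx, rfl⟩
    rw [phi_nil x hx, V0, Submodule.mem_span_singleton]
    exact ⟨x ⟨[], List.nodup_nil⟩, by funext; simp⟩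
  · rw [V0, Submodule.span_singleton_le_iff_mem]
    have hx : (fun ω : InjWord n => if ω.val = [] then (1 : ℝ) else 0) ∈ HSpace n ∅ := by
      refine ⟨fun w hw => ?_, by simp⟩
      have : w.val ≠ [] := by
        intro h
        apply hw
        simp [content, h]
      simp [this]
    exact ⟨_, hx, by rw [phi_nil _ hx]; simp⟩

theorem HSpace_card_one (A : Finset (Fin n)) (hA : A.card = 1) (x : InjWord n → ℝ)
    (hx : x ∈ HSpace n A) : x = 0 := by
  have h := finrank_HSpace A
  rw [hA, numDerangements_one] at h
  have := Submodule.finrank_eq_zero.1 h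
  rw [this] at hx
  exact (Submodule.mem_bot ℝ).1 hx

theorem phi_injOn (A : Finset (Fin n)) (x : InjWord n → ℝ) (hx : x ∈ HSpace n A)
    (h : phi n x = 0) : x = 0 :=
  marginal_self A x hx (by rw [h, map_zero])

theorem finrank_WSpace (A : Finset (Fin n)) :
    Module.finrank ℝ (WSpace n A) = numDerangements A.card := by
  rw [← finrank_HSpace]
  have hinj : Function.Injective ((phi n).comp (HSpace n A).subtype) := by
    rw [← LinearMap.ker_eq_bot, LinearMap.ker_eq_bot']
    intro x h
    exact Subtype.ext (phi_injOn A x.1 x.2 h)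
  have := LinearMap.finrank_range_of_inj hinj
  rw [LinearMap.range_comp, Submodule.range_subtype] at this
  exact this

/-- `L(S_n) = V⁰ ⊕ ⨁_{A ∈ P([n])} W_A` (internal direct sum), `φ_n` restricted
to `H_A` is injective with image `W_A`, and `dim W_A = d_{|A|}`. -/
theorem statement9 (n : ℕ) :
    (∀ f0 : FullWord n → ℝ, f0 ∈ V0 n →
      ∀ f : Finset (Fin n) → (FullWord n → ℝ),
        (∀ A : Finset (Fin n), 2 ≤ A.card → f A ∈ WSpace n A) →
        f0 + (∑ A ∈ Finset.univ.filter (fun A : Finset (Fin n) => 2 ≤ A.card), f A) = 0 →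
        f0 = 0 ∧ ∀ A : Finset (Fin n), 2 ≤ A.card → f A = 0) ∧
    (V0 n ⊔ (⨆ A ∈ {A : Finset (Fin n) | 2 ≤ A.card}, WSpace n A) = ⊤) ∧
    (∀ A : Finset (Fin n), 2 ≤ A.card →
      (∀ x ∈ HSpace n A, ∀ y ∈ HSpace n A, phi n x = phi n y → x = y) ∧
      Submodule.map (phi n) (HSpace n A) = WSpace n A ∧
      Module.finrank ℝ (WSpace n A) = numDerangements A.card) := by
  refine ⟨?_, ?_, ?_⟩
  · intro f0 hf0 f hf hsum
    rw [← WSpace_empty] at hf0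
    obtain ⟨x0, hx0, rfl⟩ := hf0
    have hex : ∀ A : Finset (Fin n), ∃ x ∈ HSpace n A, 2 ≤ A.card → phi n x = f A := by
      intro A
      by_cases hA : 2 ≤ A.card
      · obtain ⟨x, hx, e⟩ := hf A hA
        exact ⟨x, hx, fun _ => e⟩
      · exact ⟨0, Submodule.zero_mem _, fun h => absurd h hA⟩
    choose y hy hyf using hex
    let x : (A : Finset (Fin n)) → InjWord n → ℝ := fun A =>
      if A = ∅ then x0 else if 2 ≤ A.card then y A else 0
    have hx : ∀ A, x A ∈ HSpace n A := by
      intro A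
      by_cases h0 : A = ∅
      · subst h0; simpa [x] using hx0
      · by_cases h2 : 2 ≤ A.card
        · simpa [x, h0, h2] using hy A
        · simp [x, h0, h2]
    have hS : ∑ A, phi n (x A) = 0 := by
      rw [← hsum, ← Finset.add_sum_erase _ _ (Finset.mem_univ ∅)]
      congr 1
      symm
      apply Finset.sum_subset_zero_on_sdiff
      · intro A hA
        simp only [Finset.mem_filter, Finset.mem_univ, true_and] at hA
        simp only [Finset.mem_erase, Finset.mem_univ, and_true]
        rintro rfl
        simp at hA
      · intro A hA
        simp only [Finset.mem_sdiff, Finset.mem_erase, Finset.mem_filter, Finset.mem_univ,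
          true_and, and_true] at hA
        simp [x, hA.1, hA.2]
      · intro A hA
        simp only [Finset.mem_filter, Finset.mem_univ, true_and] at hA
        have h0 : A ≠ ∅ := by
          rintro rfl
          simp at hA
        simp [x, h0, hA, hyf A hA]
    have hz := indep x hx hS
    constructor
    · have := hz ∅
      simp only [x, if_true] at this
      rw [this, map_zero]
    · intro A hA
      have h0 : A ≠ ∅ := by
        rintro rfl
        simp at hA
      have := hz A
      simp only [x, h0, hA, if_true, if_false] at this
      rw [← hyf A hA, this, map_zero]
  · rw [eq_top_iff]
    intro f _
    obtain ⟨x, rfl⟩ := bigPhi_surj n f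
    rw [bigPhi_apply]
    refine Submodule.sum_mem _ fun A _ => ?_
    have hm : phi n (x A).1 ∈ WSpace n A := ⟨_, (x A).2, rfl⟩
    rcases Nat.lt_or_ge A.card 2 with h | h
    · rcases Nat.lt_or_ge A.card 1 with h1 | h1
      · have h0 : A = ∅ := Finset.card_eq_zero.1 (by omega)
        rw [h0, WSpace_empty] at hm
        rw [h0]
        exact Submodule.mem_sup_left hm
      · rw [HSpace_card_one A (by omega) _ (x A).2, map_zero]
        exact Submodule.zero_mem _
    · apply Submodule.mem_sup_right
      exact Submodule.mem_iSup_of_mem A (Submodule.mem_iSup_of_mem h hm)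
  · intro A hA
    refine ⟨?_, rfl, finrank_WSpace A⟩
    intro x hx y hy h
    have := phi_injOn A (x - y) (Submodule.sub_mem _ hx hy) (by rw [map_sub, h, sub_self])
    exact sub_eq_zero.1 this

end IncompleteRankings
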